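/- arXiv:1102.0534 — 2 statements merged into one kernel-verified Lean document; each statement's English description precedes it below -/
import Mathlib

section
/- Let k ≤ n be positive integers and let G be an n × k random matrix with independent N(0, 1/n) entries. Then the expected spectral norm satisfies E ‖G‖ ≤ 1 + √(k/n), where ‖·‖ denotes the operator norm from ℓ₂^k to ℓ₂^n. -/
open MeasureTheory ProbabilityTheory Matrix

/-- The space of `n × k` real matrices carries the product measurable structure. -/
instance matrixMeasurableSpace (n k : ℕ) : MeasurableSpace (Matrix (Fin n) (Fin k) ℝ) :=
  MeasurableSpace.pi

/-- The Euclidean (ℓ₂) norm of a vector in `ℝ^m`. -/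
noncomputable def euclNorm {m : ℕ} (v : Fin m → ℝ) : ℝ :=
  Real.sqrt (∑ i, v i ^ 2)

/-- The spectral norm of an `a × b` real matrix: its operator norm `ℓ₂^b → ℓ₂^a`. -/
noncomputable def specNorm {a b : ℕ} (M : Matrix (Fin a) (Fin b) ℝ) : ℝ :=
  sSup {r : ℝ | ∃ x : Fin b → ℝ, euclNorm x ≤ 1 ∧ r = euclNorm (M.mulVec x)}

lemma hasDerivAt_gaussianPDFReal_zero (v : NNReal) (x : ℝ) :
    HasDerivAt (gaussianPDFReal 0 v) (-(x / v) * gaussianPDFReal 0 v x) x := by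
  have h : HasDerivAt (fun y : ℝ => -(y - 0) ^ 2 / (2 * (v : ℝ))) (-(x / v)) x := by
    have := (((hasDerivAt_id x).sub_const 0).pow 2).neg.div_const (2 * (v : ℝ))
    refine this.congr_deriv ?_
    simp only [id, sub_zero, Nat.cast_ofNat]
    rw [show -(2 * x ^ (2 - 1) * 1) = 2 * -x by ring, mul_div_mul_left _ _ two_ne_zero, neg_div]
  rw [gaussianPDFReal_def]
  exact (h.exp.const_mul _).congr_deriv (by ring)

lemma integrable_id_gaussianReal' (v : NNReal) :
    Integrable (fun x : ℝ => x) (gaussianReal 0 v) :=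
  (memLp_id_gaussianReal 1).integrable (by simp)

/-- Stein's identity for a bounded function with bounded derivative. -/
lemma integral_id_mul_gaussianReal {v : NNReal} (hv : v ≠ 0) {f f' : ℝ → ℝ} {C : ℝ}
    (hf : ∀ x, HasDerivAt f (f' x) x) (hfC : ∀ x, |f x| ≤ C) (hf'C : ∀ x, |f' x| ≤ C) :
    ∫ x, x * f x ∂gaussianReal 0 v = v * ∫ x, f' x ∂gaussianReal 0 v := by
  have hv' : (v : ℝ) ≠ 0 := by exact_mod_cast hv
  have hfm : Measurable f := (continuous_iff_continuousAt.2 fun x => (hf x).continuousAt).measurable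
  have hfm' : Measurable f' := by
    rw [show f' = deriv f from funext fun x => (hf x).deriv.symm]
    exact measurable_deriv f
  have hp := integrable_gaussianPDFReal 0 v
  have hxp : Integrable (fun x => x * gaussianPDFReal 0 v x) := by
    have := integrable_id_gaussianReal' v
    rw [gaussianReal_of_var_ne_zero 0 hv, integrable_withDensity_iff_integrable_smul'
      (measurable_gaussianPDF 0 v) (by simp [gaussianPDF_lt_top])] at this
    refine this.congr (ae_of_all _ fun x => ?_)
    simp [toReal_gaussianPDF, mul_comm]
  have key := integral_mul_deriv_eq_deriv_mul_of_integrable (u := f) (u' := f')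
    (v := gaussianPDFReal 0 v) (v' := fun x => -(x / v) * gaussianPDFReal 0 v x)
    (fun x _ => hf x) (fun x _ => hasDerivAt_gaussianPDFReal_zero v x)
    (Integrable.bdd_mul (c := C)
      ((hxp.const_mul (-(v : ℝ)⁻¹)).congr (ae_of_all _ fun x => by simp only []; ring))
      hfm.aestronglyMeasurable (ae_of_all _ hfC))
    (hp.bdd_mul (c := C) hfm'.aestronglyMeasurable (ae_of_all _ hf'C))
    (hp.bdd_mul (c := C) hfm.aestronglyMeasurable (ae_of_all _ hfC))
  rw [integral_gaussianReal_eq_integral_smul hv, integral_gaussianReal_eq_integral_smul hv]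
  have e1 : ∫ x, gaussianPDFReal 0 v x • (x * f x)
      = -v * ∫ x, f x * (-(x / v) * gaussianPDFReal 0 v x) := by
    rw [← integral_const_mul]
    refine integral_congr_ae (ae_of_all _ fun x => ?_)
    simp only [smul_eq_mul]
    field_simp
  rw [e1, key]
  simp only [smul_eq_mul, neg_mul, mul_neg, neg_neg, mul_comm]

section Pi
variable {ι : Type*} [Fintype ι]

lemma integrable_eval_pi_gaussianReal (v : NNReal) (c : ι) :
    Integrable (fun ω : ι → ℝ => ω c) (Measure.pi fun _ => gaussianReal 0 v) :=
  (measurePreserving_eval (fun _ : ι => gaussianReal 0 v) c).integrable_comp_of_integrable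
    (integrable_id_gaussianReal' v)

variable [DecidableEq ι]

lemma measurePreserving_update_pi {X : ι → Type*} [∀ i, MeasurableSpace (X i)]
    (μ : ∀ i, Measure (X i)) [∀ i, IsProbabilityMeasure (μ i)] (c : ι) :
    MeasurePreserving (fun p : X c × (∀ i, X i) => Function.update p.2 c p.1)
      ((μ c).prod (Measure.pi μ)) (Measure.pi μ) := by
  have hm : Measurable (fun p : X c × (∀ i, X i) => Function.update p.2 c p.1) := by
    rw [measurable_pi_iff]
    intro i
    by_cases h : i = c
    · subst h; simpa using measurable_fst
    · simpa [h, Function.comp_def] using (measurable_pi_apply i).comp measurable_snd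
  refine ⟨hm, (Measure.pi_eq fun s hs => ?_).symm⟩
  have hpre : (fun p : X c × (∀ i, X i) => Function.update p.2 c p.1) ⁻¹' Set.univ.pi s
      = s c ×ˢ Set.univ.pi (Function.update s c Set.univ) := by
    ext p
    simp only [Set.mem_preimage, Set.mem_univ_pi, Set.mem_prod]
    constructor
    · intro h
      refine ⟨by simpa using h c, fun i => ?_⟩
      by_cases hi : i = c
      · subst hi; simp
      · simpa [hi] using h i
    · rintro ⟨h1, h2⟩ i
      by_cases hi : i = c
      · subst hi; simpa using h1
      · simpa [hi] using h2 i
  rw [Measure.map_apply hm (MeasurableSet.univ_pi hs), hpre, Measure.prod_prod, Measure.pi_pi,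
    ← Finset.mul_prod_erase _ _ (Finset.mem_univ c), ← Finset.mul_prod_erase _ (fun i => μ i (s i))
    (Finset.mem_univ c)]
  simp only [Function.update_self, measure_univ, one_mul]
  congr 1
  refine Finset.prod_congr rfl fun i hi => ?_
  rw [Function.update_of_ne (Finset.ne_of_mem_erase hi)]

/-- Gaussian integration by parts in one coordinate of a product. -/
lemma integral_eval_mul_pi_gaussianReal {v : NNReal} (hv : v ≠ 0) (c : ι)
    {f f' : (ι → ℝ) → ℝ} {C : ℝ} (hfm : Measurable f) (hfm' : Measurable f')
    (hf : ∀ ω, HasDerivAt (fun x => f (Function.update ω c x)) (f' ω) (ω c))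
    (hfC : ∀ ω, |f ω| ≤ C) (hf'C : ∀ ω, |f' ω| ≤ C) :
    ∫ ω, ω c * f ω ∂(Measure.pi fun _ : ι => gaussianReal 0 v)
      = v * ∫ ω, f' ω ∂(Measure.pi fun _ : ι => gaussianReal 0 v) := by
  have mp := measurePreserving_update_pi (fun _ : ι => gaussianReal 0 v) c
  have resample : ∀ g : (ι → ℝ) → ℝ, Integrable g (Measure.pi fun _ : ι => gaussianReal 0 v) →
      ∫ ω, g ω ∂(Measure.pi fun _ : ι => gaussianReal 0 v)
      = ∫ ω, ∫ x, g (Function.update ω c x) ∂gaussianReal 0 v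
          ∂(Measure.pi fun _ : ι => gaussianReal 0 v) := by
    intro g hg
    conv_lhs => rw [← mp.map_eq]
    rw [integral_map mp.measurable.aemeasurable (by rw [mp.map_eq]; exact hg.aestronglyMeasurable)]
    exact integral_prod_symm _ (mp.integrable_comp_of_integrable hg)
  have hi' : Integrable f' (Measure.pi fun _ : ι => gaussianReal 0 v) :=
    Integrable.of_bound hfm'.aestronglyMeasurable C (ae_of_all _ hf'C)
  have hi : Integrable (fun ω => ω c * f ω) (Measure.pi fun _ : ι => gaussianReal 0 v) :=
    (integrable_eval_pi_gaussianReal v c).mul_bdd (c := C) hfm.aestronglyMeasurable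
      (ae_of_all _ hfC)
  rw [resample _ hi, resample _ hi', ← integral_const_mul]
  refine integral_congr_ae (ae_of_all _ fun ω => ?_)
  simp only [Function.update_self]
  refine integral_id_mul_gaussianReal hv (fun x => ?_) (fun x => hfC _) (fun x => hf'C _)
  simpa using hf (Function.update ω c x)

end Pi

section Softmax
variable {T : Type*} [Fintype T]

/-- The logarithm of the sum of the exponentials of a finite family. -/
noncomputable def logSumExp (z : T → ℝ) : ℝ := Real.log (∑ t, Real.exp (z t))

/-- The Gibbs weights of a finite family, i.e. the gradient of `logSumExp`. -/
noncomputable def softmax (z : T → ℝ) (t : T) : ℝ := Real.exp (z t) / ∑ s, Real.exp (z s)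

lemma softmax_nonneg (z : T → ℝ) (t : T) : 0 ≤ softmax z t := by
  unfold softmax; positivity

lemma sum_exp_pos [Nonempty T] (z : T → ℝ) : 0 < ∑ t, Real.exp (z t) :=
  Finset.sum_pos (fun _ _ => Real.exp_pos _) Finset.univ_nonempty

lemma sum_softmax [Nonempty T] (z : T → ℝ) : ∑ t, softmax z t = 1 := by
  unfold softmax
  rw [← Finset.sum_div, div_self (sum_exp_pos z).ne']

lemma softmax_le_one [Nonempty T] (z : T → ℝ) (t : T) : softmax z t ≤ 1 := by
  rw [← sum_softmax z]
  exact Finset.single_le_sum (fun s _ => softmax_nonneg z s) (Finset.mem_univ t)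

lemma continuous_logSumExp [Nonempty T] : Continuous (logSumExp : (T → ℝ) → ℝ) := by
  unfold logSumExp
  exact Continuous.log (by fun_prop) fun z => (sum_exp_pos z).ne'

lemma continuous_softmax [Nonempty T] (t : T) : Continuous fun z : T → ℝ => softmax z t := by
  unfold softmax
  exact Continuous.div (by fun_prop) (by fun_prop) fun z => (sum_exp_pos z).ne'

lemma hasDerivAt_logSumExp [Nonempty T] {z : ℝ → T → ℝ} {z' : T → ℝ} {x : ℝ}
    (hz : ∀ t, HasDerivAt (fun y => z y t) (z' t) x) :
    HasDerivAt (fun y => logSumExp (z y)) (∑ t, softmax (z x) t * z' t) x := by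
  have h := (HasDerivAt.fun_sum fun t (_ : t ∈ Finset.univ) => (hz t).exp).log
    (sum_exp_pos (z x)).ne'
  refine h.congr_deriv ?_
  rw [Finset.sum_div]
  exact Finset.sum_congr rfl fun t _ => by unfold softmax; ring

lemma hasDerivAt_softmax [Nonempty T] {z : ℝ → T → ℝ} {z' : T → ℝ} {x : ℝ}
    (hz : ∀ t, HasDerivAt (fun y => z y t) (z' t) x) (t : T) :
    HasDerivAt (fun y => softmax (z y) t)
      (softmax (z x) t * (z' t - ∑ s, softmax (z x) s * z' s)) x := by
  have h0 := (sum_exp_pos (z x)).ne'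
  have h := (hz t).exp.div
    (HasDerivAt.fun_sum fun t (_ : t ∈ Finset.univ) => (hz t).exp) h0
  refine h.congr_deriv ?_
  have e : ∑ s, softmax (z x) s * z' s
      = (∑ s, Real.exp (z x s) * z' s) / ∑ s, Real.exp (z x s) := by
    rw [Finset.sum_div]
    exact Finset.sum_congr rfl fun t _ => by unfold softmax; ring
  rw [e, softmax]
  field_simp

lemma le_logSumExp (z : T → ℝ) (t : T) : z t ≤ logSumExp z := by
  rw [logSumExp, Real.le_log_iff_exp_le ((Real.exp_pos (z t)).trans_le ?_)] <;>
  exact Finset.single_le_sum (fun s _ => (Real.exp_pos (z s)).le) (Finset.mem_univ t)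

lemma logSumExp_le [Nonempty T] {z : T → ℝ} {M : ℝ} (h : ∀ t, z t ≤ M) :
    logSumExp z ≤ Real.log (Fintype.card T) + M := by
  have hT : (Fintype.card T : ℝ) ≠ 0 := by exact_mod_cast Fintype.card_ne_zero
  rw [← Real.log_exp M, ← Real.log_mul hT (Real.exp_pos M).ne', logSumExp]
  refine Real.log_le_log (sum_exp_pos z) ?_
  calc ∑ t, Real.exp (z t) ≤ ∑ _t : T, Real.exp M :=
        Finset.sum_le_sum fun t _ => Real.exp_le_exp.2 (h t)
    _ = _ := by simp

lemma abs_logSumExp_le [Nonempty T] (z : T → ℝ) :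
    |logSumExp z| ≤ Real.log (Fintype.card T) + ∑ t, |z t| := by
  have h : ∀ t, |z t| ≤ ∑ t, |z t| := fun t =>
    Finset.single_le_sum (fun s _ => abs_nonneg (z s)) (Finset.mem_univ t)
  have hlog : 0 ≤ Real.log (Fintype.card T) := Real.log_natCast_nonneg _
  refine abs_le.2 ⟨?_, logSumExp_le fun t => (le_abs_self _).trans (h t)⟩
  obtain ⟨t⟩ := ‹Nonempty T›
  linarith [le_logSumExp z t, neg_abs_le (z t), h t]

end Softmax

section Comparison
variable {ι T : Type*} [Fintype ι]

lemma integrable_mulVec_pi_gaussianReal (v : NNReal) (A : Matrix T ι ℝ) (t : T) :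
    Integrable (fun ω : ι → ℝ => (A *ᵥ ω) t) (Measure.pi fun _ => gaussianReal 0 v) := by
  simp only [mulVec, dotProduct]
  exact integrable_finsetSum _ fun c _ => (integrable_eval_pi_gaussianReal v c).const_mul _

variable [Fintype T] [Nonempty T]

lemma integrable_logSumExp_mulVec (v : NNReal) (A : Matrix T ι ℝ) :
    Integrable (fun ω : ι → ℝ => logSumExp (A *ᵥ ω)) (Measure.pi fun _ => gaussianReal 0 v) := by
  refine Integrable.mono' (g := fun ω : ι → ℝ => Real.log (Fintype.card T) + ∑ t, |(A *ᵥ ω) t|)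
    ?_ ?_ (ae_of_all _ fun ω => abs_logSumExp_le _)
  · exact (integrable_const _).add
      (integrable_finsetSum _ fun t _ => (integrable_mulVec_pi_gaussianReal v A t).abs)
  · exact (continuous_logSumExp.comp (by fun_prop)).aestronglyMeasurable

/-- Integration by parts for the Gibbs weights of a linear Gaussian family, paired with a second
family. -/
lemma integral_sum_softmax_mul_mulVec {v : NNReal} (hv : v ≠ 0) (L L' : Matrix T ι ℝ) :
    ∫ ω, ∑ t, softmax (L *ᵥ ω) t * (L' *ᵥ ω) t ∂(Measure.pi fun _ : ι => gaussianReal 0 v)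
      = v / 2 * ∫ ω, ∑ t, ∑ s, softmax (L *ᵥ ω) t * softmax (L *ᵥ ω) s *
          ((L' t - L' s) ⬝ᵥ (L t - L s)) ∂(Measure.pi fun _ : ι => gaussianReal 0 v) := by
  classical
  set μ := Measure.pi fun _ : ι => gaussianReal 0 v
  have hcont : ∀ t, Continuous fun ω : ι → ℝ => softmax (L *ᵥ ω) t := fun t =>
    (continuous_softmax t).comp (by fun_prop)
  have hbd : ∀ (ω : ι → ℝ) t, |softmax (L *ᵥ ω) t| ≤ 1 := fun ω t => by
    rw [abs_of_nonneg (softmax_nonneg _ _)]; exact softmax_le_one _ _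
  set D : T → ι → (ι → ℝ) → ℝ := fun t c ω =>
    softmax (L *ᵥ ω) t * (L t c - ∑ s, softmax (L *ᵥ ω) s * L s c) with hD
  have hDcont : ∀ t c, Continuous (D t c) := fun t c =>
    (hcont t).mul (continuous_const.sub (continuous_finsetSum _ fun s _ =>
      (hcont s).mul continuous_const))
  have hDbd : ∀ t c ω, |D t c ω| ≤ |L t c| + ∑ s, |L s c| := by
    intro t c ω
    have h1 : |L t c - ∑ s, softmax (L *ᵥ ω) s * L s c| ≤ |L t c| + ∑ s, |L s c| := by
      refine (abs_sub _ _).trans (add_le_add le_rfl ((Finset.abs_sum_le_sum_abs _ _).trans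
        (Finset.sum_le_sum fun s _ => ?_)))
      rw [abs_mul]
      exact mul_le_of_le_one_left (abs_nonneg _) (hbd ω s)
    rw [hD]
    simp only [abs_mul]
    exact (mul_le_of_le_one_left (abs_nonneg _) (hbd ω t)).trans h1
  have hDint : ∀ t c, Integrable (D t c) μ := fun t c =>
    Integrable.of_bound (hDcont t c).aestronglyMeasurable _ (ae_of_all _ (hDbd t c))
  have ibp : ∀ t c, ∫ ω, ω c * softmax (L *ᵥ ω) t ∂μ = v * ∫ ω, D t c ω ∂μ := by
    intro t c
    refine integral_eval_mul_pi_gaussianReal hv c (C := max 1 (|L t c| + ∑ s, |L s c|))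
      (hcont t).measurable (hDcont t c).measurable (fun ω => ?_)
      (fun ω => (hbd ω t).trans (le_max_left _ _)) (fun ω => (hDbd t c ω).trans (le_max_right _ _))
    have h : ∀ s, HasDerivAt (fun x => (L *ᵥ Function.update ω c x) s) (L s c) (ω c) := by
      intro s
      have e : (fun x => (L *ᵥ Function.update ω c x) s)
          = fun x => L s c * x + ∑ i ∈ Finset.univ.erase c, L s i * ω i := by
        funext x
        simp only [mulVec, dotProduct]
        rw [← Finset.add_sum_erase _ _ (Finset.mem_univ c), Function.update_self]
        congr 1
        refine Finset.sum_congr rfl fun i hi => ?_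
        rw [Function.update_of_ne (Finset.ne_of_mem_erase hi)]
      rw [e]
      exact (((hasDerivAt_id (ω c)).const_mul (L s c)).add_const _).congr_deriv (by simp)
    have := hasDerivAt_softmax h t
    simpa only [Function.update_eq_self] using this
  have hi1 : ∀ t c, Integrable (fun ω => L' t c * (ω c * softmax (L *ᵥ ω) t)) μ := fun t c =>
    ((integrable_eval_pi_gaussianReal v c).mul_bdd (c := 1) (hcont t).aestronglyMeasurable
      (ae_of_all _ fun ω => hbd ω t)).const_mul _
  have hi2 : ∀ t c, Integrable (fun ω => L' t c * D t c ω) μ := fun t c => (hDint t c).const_mul _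
  calc ∫ ω, ∑ t, softmax (L *ᵥ ω) t * (L' *ᵥ ω) t ∂μ
      = ∫ ω, ∑ t, ∑ c, L' t c * (ω c * softmax (L *ᵥ ω) t) ∂μ := by
        congr 1; funext ω
        simp only [mulVec, dotProduct, Finset.mul_sum]
        exact Finset.sum_congr rfl fun t _ => Finset.sum_congr rfl fun c _ => by ring
    _ = ∑ t, ∑ c, L' t c * (v * ∫ ω, D t c ω ∂μ) := by
        rw [integral_finsetSum _ fun t _ => integrable_finsetSum _ fun c _ => hi1 t c]
        refine Finset.sum_congr rfl fun t _ => ?_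
        rw [integral_finsetSum _ fun c _ => hi1 t c]
        refine Finset.sum_congr rfl fun c _ => ?_
        rw [integral_const_mul, ibp]
    _ = v * ∫ ω, ∑ t, ∑ c, L' t c * D t c ω ∂μ := by
        rw [integral_finsetSum _ fun t _ => integrable_finsetSum _ fun c _ => hi2 t c,
           Finset.mul_sum]
        refine Finset.sum_congr rfl fun t _ => ?_
        rw [integral_finsetSum _ fun c _ => hi2 t c, Finset.mul_sum]
        refine Finset.sum_congr rfl fun c _ => ?_
        rw [integral_const_mul]; ring
    _ = _ := by
        rw [div_mul_eq_mul_div, mul_div_assoc, ← integral_div]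
        congr 2; funext ω
        set p := softmax (L *ᵥ ω)
        have hp : ∑ s, p s = 1 := sum_softmax _
        have e1 : ∑ t, ∑ c, L' t c * D t c ω
            = ∑ t, ∑ s, p t * p s * (L' t ⬝ᵥ (L t - L s)) := by
          refine Finset.sum_congr rfl fun t _ => ?_
          simp only [dotProduct, Finset.mul_sum]
          rw [Finset.sum_comm]
          refine Finset.sum_congr rfl fun c _ => ?_
          have : L t c - ∑ s, p s * L s c = ∑ s, p s * (L t c - L s c) := by
            simp only [mul_sub, Finset.sum_sub_distrib, ← Finset.sum_mul, hp, one_mul]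
          simp only [hD]
          rw [this, Finset.mul_sum, Finset.mul_sum]
          exact Finset.sum_congr rfl fun s _ => by simp only [Pi.sub_apply]; ring
        have e2 : ∑ t, ∑ s, p t * p s * (L' t ⬝ᵥ (L t - L s))
            = ∑ t, ∑ s, p t * p s * (L' s ⬝ᵥ (L s - L t)) := by
          rw [Finset.sum_comm]
          exact Finset.sum_congr rfl fun t _ => Finset.sum_congr rfl fun s _ => by ring
        have e3 : ∑ t, ∑ s, p t * p s * ((L' t - L' s) ⬝ᵥ (L t - L s))
            = ∑ t, ∑ s, p t * p s * (L' t ⬝ᵥ (L t - L s))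
              + ∑ t, ∑ s, p t * p s * (L' s ⬝ᵥ (L s - L t)) := by
          simp only [← Finset.sum_add_distrib]
          refine Finset.sum_congr rfl fun t _ => Finset.sum_congr rfl fun s _ => ?_
          rw [← neg_sub (L t) (L s), dotProduct_neg, sub_dotProduct]; ring
        rw [e3, ← e2, e1]; ring

/-- The Sudakov–Fernique comparison for `logSumExp`: if the increments of the Gaussian family given
by the rows of `A` are dominated by those of `B`, and the two families are independent, then the
expected `logSumExp` of the first is at most that of the second. -/
theorem integral_logSumExp_mulVec_le {v : NNReal} (hv : v ≠ 0) {A B : Matrix T ι ℝ}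
    (hAB : ∀ t s, A t ⬝ᵥ B s = 0)
    (hle : ∀ t s, (A t - A s) ⬝ᵥ (A t - A s) ≤ (B t - B s) ⬝ᵥ (B t - B s)) :
    ∫ ω, logSumExp (A *ᵥ ω) ∂(Measure.pi fun _ : ι => gaussianReal 0 v)
      ≤ ∫ ω, logSumExp (B *ᵥ ω) ∂(Measure.pi fun _ : ι => gaussianReal 0 v) := by
  set μ := Measure.pi fun _ : ι => gaussianReal 0 v
  set L : ℝ → Matrix T ι ℝ := fun θ => Real.cos θ • A + Real.sin θ • B with hL
  set L' : ℝ → Matrix T ι ℝ := fun θ => -Real.sin θ • A + Real.cos θ • B with hL'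
  have hderiv : ∀ θ, HasDerivAt (fun θ => ∫ ω, logSumExp (L θ *ᵥ ω) ∂μ)
      (∫ ω, ∑ t, softmax (L θ *ᵥ ω) t * (L' θ *ᵥ ω) t ∂μ) θ := by
    intro θ
    refine (hasDerivAt_integral_of_dominated_loc_of_deriv_le (s := Set.univ)
      (F := fun θ ω => logSumExp (L θ *ᵥ ω))
      (F' := fun θ ω => ∑ t, softmax (L θ *ᵥ ω) t * (L' θ *ᵥ ω) t)
      (bound := fun ω => ∑ t, (|(A *ᵥ ω) t| + |(B *ᵥ ω) t|)) Filter.univ_mem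
      (Filter.Eventually.of_forall fun θ =>
        (integrable_logSumExp_mulVec v (L θ)).aestronglyMeasurable)
      (integrable_logSumExp_mulVec v (L θ)) ?_ ?_ ?_ ?_).2
    · refine (continuous_finsetSum _ fun t _ => Continuous.mul ?_ ?_).aestronglyMeasurable
      · exact (continuous_softmax t).comp (by fun_prop)
      · exact (continuous_apply t).comp (by fun_prop : Continuous fun ω : ι → ℝ => L' θ *ᵥ ω)
    · refine ae_of_all _ fun ω θ _ => ?_
      refine (Finset.abs_sum_le_sum_abs _ _).trans (Finset.sum_le_sum fun t _ => ?_)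
      rw [abs_mul, abs_of_nonneg (softmax_nonneg _ _)]
      refine (mul_le_of_le_one_left (abs_nonneg _) (softmax_le_one _ _)).trans ?_
      simp only [hL', add_mulVec, smul_mulVec, Pi.add_apply, Pi.smul_apply, smul_eq_mul]
      refine (abs_add_le _ _).trans (add_le_add ?_ ?_)
      · rw [abs_mul, abs_neg]
        exact mul_le_of_le_one_left (abs_nonneg _) (Real.abs_sin_le_one θ)
      · rw [abs_mul]
        exact mul_le_of_le_one_left (abs_nonneg _) (Real.abs_cos_le_one θ)
    · exact integrable_finsetSum _ fun t _ => (integrable_mulVec_pi_gaussianReal v A t).abs.add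
        (integrable_mulVec_pi_gaussianReal v B t).abs
    · refine ae_of_all _ fun ω θ _ => hasDerivAt_logSumExp fun t => ?_
      simp only [hL, hL', add_mulVec, smul_mulVec, Pi.add_apply, Pi.smul_apply, smul_eq_mul]
      exact ((Real.hasDerivAt_cos θ).mul_const _).add ((Real.hasDerivAt_sin θ).mul_const _)
  have hpos : ∀ θ ∈ interior (Set.Icc 0 (Real.pi / 2)),
      0 ≤ deriv (fun θ => ∫ ω, logSumExp (L θ *ᵥ ω) ∂μ) θ := by
    intro θ hθ
    rw [interior_Icc] at hθ
    have hs : 0 ≤ Real.sin θ := Real.sin_nonneg_of_nonneg_of_le_pi hθ.1.le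
      (by linarith [hθ.2, Real.pi_pos])
    have hc : 0 ≤ Real.cos θ := Real.cos_nonneg_of_mem_Icc
      ⟨by linarith [hθ.1, Real.pi_pos], hθ.2.le⟩
    rw [(hderiv θ).deriv, integral_sum_softmax_mul_mulVec hv]
    refine mul_nonneg (by positivity) (integral_nonneg fun ω => Finset.sum_nonneg fun t _ =>
      Finset.sum_nonneg fun s _ => mul_nonneg
        (mul_nonneg (softmax_nonneg _ _) (softmax_nonneg _ _)) ?_)
    have h0 : (A t - A s) ⬝ᵥ (B t - B s) = 0 := by
      simp [sub_dotProduct, dotProduct_sub, hAB]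
    have e : (L' θ t - L' θ s) ⬝ᵥ (L θ t - L θ s) = Real.sin θ * Real.cos θ *
        ((B t - B s) ⬝ᵥ (B t - B s) - (A t - A s) ⬝ᵥ (A t - A s)) := by
      have e1 : L' θ t - L' θ s = -Real.sin θ • (A t - A s) + Real.cos θ • (B t - B s) := by
        ext c; simp [hL']; ring
      have e2 : L θ t - L θ s = Real.cos θ • (A t - A s) + Real.sin θ • (B t - B s) := by
        ext c; simp [hL]; ring
      rw [e1, e2]
      simp only [add_dotProduct, dotProduct_add, smul_dotProduct, dotProduct_smul, smul_eq_mul,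
        dotProduct_comm (B t - B s) (A t - A s), h0]
      ring
    rw [e]
    exact mul_nonneg (mul_nonneg hs hc) (sub_nonneg.2 (hle t s))
  have hmono := monotoneOn_of_deriv_nonneg (convex_Icc 0 (Real.pi / 2))
    (fun θ _ => (hderiv θ).continuousAt.continuousWithinAt)
    (fun θ _ => (hderiv θ).differentiableAt.differentiableWithinAt) hpos
  have hpi := Real.pi_pos
  have := hmono (Set.left_mem_Icc.2 (by positivity)) (Set.right_mem_Icc.2 (by positivity))
    (by positivity)
  simpa [hL] using this

/-- The Sudakov–Fernique comparison for maxima of independent Gaussian families. -/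
theorem integral_le_integral_of_mulVec {v : NNReal} (hv : v ≠ 0) {A B : Matrix T ι ℝ}
    (hAB : ∀ t s, A t ⬝ᵥ B s = 0)
    (hle : ∀ t s, (A t - A s) ⬝ᵥ (A t - A s) ≤ (B t - B s) ⬝ᵥ (B t - B s))
    {X Y : (ι → ℝ) → ℝ} (hX : Integrable X (Measure.pi fun _ => gaussianReal 0 v))
    (hY : Integrable Y (Measure.pi fun _ => gaussianReal 0 v))
    (hXA : ∀ ω, ∃ t, X ω ≤ (A *ᵥ ω) t) (hBY : ∀ ω t, (B *ᵥ ω) t ≤ Y ω) :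
    ∫ ω, X ω ∂(Measure.pi fun _ => gaussianReal 0 v)
      ≤ ∫ ω, Y ω ∂(Measure.pi fun _ => gaussianReal 0 v) := by
  set μ := Measure.pi fun _ : ι => gaussianReal 0 v
  have scaled : ∀ β : ℝ, 0 < β →
      β * ∫ ω, X ω ∂μ ≤ Real.log (Fintype.card T) + β * ∫ ω, Y ω ∂μ := by
    intro β hβ
    have incr : ∀ (C : Matrix T ι ℝ) t s, ((β • C) t - (β • C) s) ⬝ᵥ ((β • C) t - (β • C) s)
        = β * (β * ((C t - C s) ⬝ᵥ (C t - C s))) := by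
      intro C t s
      have e : (β • C) t - (β • C) s = β • (C t - C s) := by
        ext c; simp; ring
      rw [e, smul_dotProduct, dotProduct_smul, smul_eq_mul, smul_eq_mul]
    have comp := integral_logSumExp_mulVec_le hv (A := β • A) (B := β • B)
      (fun t s => by
        change (β • A t) ⬝ᵥ (β • B s) = 0
        rw [smul_dotProduct, dotProduct_smul, hAB, smul_zero, smul_zero])
      (fun t s => by
        rw [incr, incr]
        have := hle t s
        gcongr)
    calc β * ∫ ω, X ω ∂μ = ∫ ω, β * X ω ∂μ := (integral_const_mul _ _).symm
      _ ≤ ∫ ω, logSumExp ((β • A) *ᵥ ω) ∂μ := by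
        refine integral_mono (hX.const_mul β) (integrable_logSumExp_mulVec v _) fun ω => ?_
        obtain ⟨t, ht⟩ := hXA ω
        refine le_trans ?_ (le_logSumExp _ t)
        simp only [smul_mulVec, Pi.smul_apply, smul_eq_mul]
        gcongr
      _ ≤ ∫ ω, logSumExp ((β • B) *ᵥ ω) ∂μ := comp
      _ ≤ ∫ ω, (Real.log (Fintype.card T) + β * Y ω) ∂μ := by
        refine integral_mono (integrable_logSumExp_mulVec v _)
          ((integrable_const _).add (hY.const_mul β)) fun ω => logSumExp_le fun t => ?_
        simp only [smul_mulVec, Pi.smul_apply, smul_eq_mul]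
        have := hBY ω t
        gcongr
      _ = Real.log (Fintype.card T) + β * ∫ ω, Y ω ∂μ := by
        rw [integral_add (integrable_const _) (hY.const_mul β), integral_const_mul]
        simp
  by_contra! hlt
  set d := ∫ ω, X ω ∂μ - ∫ ω, Y ω ∂μ with hd
  have hd0 : 0 < d := sub_pos.2 hlt
  have hlog : 0 ≤ Real.log (Fintype.card T) := Real.log_natCast_nonneg _
  have := scaled ((Real.log (Fintype.card T) + 1) / d) (by positivity)
  have e : (Real.log (Fintype.card T) + 1) / d * d = Real.log (Fintype.card T) + 1 :=
    div_mul_cancel₀ _ hd0.ne'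
  rw [hd, mul_sub] at e
  linarith

end Comparison

section Norms
variable {ι : Type*} [Fintype ι]

lemma integrable_sq_eval_pi_gaussianReal (v : NNReal) (c : ι) :
    Integrable (fun ω : ι → ℝ => ω c ^ 2) (Measure.pi fun _ => gaussianReal 0 v) :=
  (measurePreserving_eval (fun _ : ι => gaussianReal 0 v) c).integrable_comp_of_integrable
    (g := fun x => x ^ 2) (memLp_id_gaussianReal 2).integrable_sq

lemma integral_sq_eval_pi_gaussianReal (v : NNReal) (c : ι) :
    ∫ ω, ω c ^ 2 ∂(Measure.pi fun _ : ι => gaussianReal 0 v) = v := by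
  have mp := measurePreserving_eval (fun _ : ι => gaussianReal 0 v) c
  have h := integral_map (μ := Measure.pi fun _ : ι => gaussianReal 0 v)
    mp.measurable.aemeasurable (f := fun x : ℝ => x ^ 2) (by fun_prop)
  rw [mp.map_eq] at h
  rw [← variance_id_gaussianReal (μ := 0) (v := v),
    variance_of_integral_eq_zero aemeasurable_id (by simp)]
  exact h.symm

lemma integrable_euclNorm_comp (v : NNReal) {m : ℕ} (e : Fin m → ι) :
    Integrable (fun ω : ι → ℝ => euclNorm (ω ∘ e)) (Measure.pi fun _ => gaussianReal 0 v) := by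
  refine Integrable.mono' (g := fun ω : ι → ℝ => 1 + ∑ i, ω (e i) ^ 2)
    ((integrable_const _).add
      (integrable_finsetSum _ fun i _ => integrable_sq_eval_pi_gaussianReal v (e i)))
    (by unfold euclNorm; exact Continuous.aestronglyMeasurable (by fun_prop))
    (ae_of_all _ fun ω => ?_)
  have hq : 0 ≤ ∑ i, ω (e i) ^ 2 := Finset.sum_nonneg fun i _ => sq_nonneg _
  rw [euclNorm, Real.norm_of_nonneg (Real.sqrt_nonneg _)]
  exact Real.sqrt_le_iff.2 ⟨by positivity, by simp only [Function.comp_apply]; nlinarith⟩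

lemma integral_euclNorm_comp_le {v : NNReal} (hv : v ≠ 0) {m : ℕ} (hm : 0 < m) (e : Fin m → ι) :
    ∫ ω, euclNorm (ω ∘ e) ∂(Measure.pi fun _ : ι => gaussianReal 0 v) ≤ Real.sqrt (m * v) := by
  have hmv : 0 < (m : ℝ) * v := mul_pos (by exact_mod_cast hm) (by exact_mod_cast hv.bot_lt)
  set s := Real.sqrt (m * v) with hs
  have hs0 : 0 < s := Real.sqrt_pos.2 hmv
  have hss : s * s = m * v := Real.mul_self_sqrt hmv.le
  have h_int : Integrable (fun ω : ι → ℝ => ∑ i, ω (e i) ^ 2)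
      (Measure.pi fun _ => gaussianReal 0 v) :=
    integrable_finsetSum _ fun i _ => integrable_sq_eval_pi_gaussianReal v (e i)
  calc _ ≤ ∫ ω : ι → ℝ, ((∑ i, ω (e i) ^ 2) / (2 * s) + s / 2)
        ∂(Measure.pi fun _ : ι => gaussianReal 0 v) := by
        refine integral_mono (integrable_euclNorm_comp v e)
          ((h_int.div_const _).add (integrable_const _)) fun ω => ?_
        have hq : 0 ≤ ∑ i, ω (e i) ^ 2 := Finset.sum_nonneg fun i _ => sq_nonneg _
        have h2 := Real.mul_self_sqrt hq
        simp only [euclNorm, Function.comp_apply]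
        rw [div_add_div _ _ (by positivity) two_ne_zero, le_div_iff₀ (by positivity)]
        nlinarith [sq_nonneg (Real.sqrt (∑ i, ω (e i) ^ 2) - s)]
    _ = s := by
        rw [integral_add (h_int.div_const _) (integrable_const _), integral_div,
          integral_finsetSum _ fun i _ => integrable_sq_eval_pi_gaussianReal v (e i)]
        simp only [integral_sq_eval_pi_gaussianReal, Finset.sum_const, Finset.card_univ,
          Fintype.card_fin, nsmul_eq_mul, ← hss]
        simp
        field_simp
        ring

end Norms

lemma dotProduct_le_euclNorm_mul {m : ℕ} (x y : Fin m → ℝ) :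
    x ⬝ᵥ y ≤ euclNorm x * euclNorm y :=
  Real.sum_mul_le_sqrt_mul_sqrt _ _ _

lemma measurePreserving_curry_inl (n k : ℕ) {κ : Type*} [Fintype κ] (γ : Measure ℝ)
    [IsProbabilityMeasure γ] :
    MeasurePreserving (fun (ω : (Fin n × Fin k) ⊕ κ → ℝ) i j => ω (Sum.inl (i, j)))
      (Measure.pi fun _ => γ) (Measure.pi fun _ : Fin n => Measure.pi fun _ : Fin k => γ) := by
  have uncurry : MeasurePreserving (fun (M : Fin n → Fin k → ℝ) (p : Fin n × Fin k) => M p.1 p.2)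
      (Measure.pi fun _ : Fin n => Measure.pi fun _ : Fin k => γ) (Measure.pi fun _ => γ) := by
    refine ⟨by fun_prop, (Measure.pi_eq fun s hs => ?_).symm⟩
    rw [Measure.map_apply (by fun_prop) (MeasurableSet.univ_pi hs)]
    have : (fun (M : Fin n → Fin k → ℝ) (p : Fin n × Fin k) => M p.1 p.2) ⁻¹' Set.univ.pi s
        = Set.univ.pi fun i => Set.univ.pi fun j => s (i, j) := by
      ext M; simp
    rw [this, Measure.pi_pi]
    simp only [Measure.pi_pi]
    rw [Fintype.prod_prod_type]
  have curry : MeasurePreserving (fun (ω : Fin n × Fin k → ℝ) i j => ω (i, j))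
      (Measure.pi fun _ => γ) (Measure.pi fun _ : Fin n => Measure.pi fun _ : Fin k => γ) := by
    refine ⟨by fun_prop, ?_⟩
    rw [← uncurry.map_eq, Measure.map_map (by fun_prop) (by fun_prop)]
    exact Measure.map_id
  exact curry.comp (measurePreserving_fst.comp
    (measurePreserving_sumPiEquivProdPi (X := fun _ : (Fin n × Fin k) ⊕ κ => ℝ) fun _ => γ))

/-- Chevet's inequality for a finite family of pairs of unit vectors. -/
theorem integral_le_of_exists_le_dotProduct_mulVec {n k : ℕ} (hn : 0 < n) (hk : 0 < k)
    {v : NNReal} (hv : v ≠ 0) {T : Type*} [Fintype T] [Nonempty T]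
    {y : T → Fin n → ℝ} {x : T → Fin k → ℝ} (hy : ∀ t, y t ⬝ᵥ y t = 1) (hx : ∀ t, x t ⬝ᵥ x t = 1)
    {S : Matrix (Fin n) (Fin k) ℝ → ℝ}
    (hS : Integrable S (Measure.pi fun _ : Fin n => Measure.pi fun _ : Fin k => gaussianReal 0 v))
    (hle : ∀ M, ∃ t, S M ≤ y t ⬝ᵥ (M *ᵥ x t)) :
    ∫ M, S M ∂(Measure.pi fun _ : Fin n => Measure.pi fun _ : Fin k => gaussianReal 0 v)
      ≤ Real.sqrt (n * v) + Real.sqrt (k * v) := by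
  have mp := measurePreserving_curry_inl n k (κ := Fin n ⊕ Fin k) (gaussianReal 0 v)
  let A : Matrix T ((Fin n × Fin k) ⊕ (Fin n ⊕ Fin k)) ℝ := fun t =>
    Sum.elim (fun p => y t p.1 * x t p.2) 0
  let B : Matrix T ((Fin n × Fin k) ⊕ (Fin n ⊕ Fin k)) ℝ := fun t =>
    Sum.elim 0 (Sum.elim (y t) (x t))
  have euclNorm_one : ∀ {m : ℕ} {z : Fin m → ℝ}, z ⬝ᵥ z = 1 → euclNorm z = 1 := by
    intro m z hz
    rw [euclNorm, Real.sqrt_eq_one, ← hz]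
    exact Finset.sum_congr rfl fun i _ => sq _
  have hAA : ∀ t s, A t ⬝ᵥ A s = (y t ⬝ᵥ y s) * (x t ⬝ᵥ x s) := by
    intro t s
    simp only [A, dotProduct, Fintype.sum_sum_type, Fintype.sum_prod_type, Sum.elim_inl,
      Sum.elim_inr, Finset.sum_mul_sum, Pi.zero_apply, zero_mul, Finset.sum_const_zero, add_zero]
    exact Finset.sum_congr rfl fun i _ => Finset.sum_congr rfl fun j _ => by ring
  have hBB : ∀ t s, B t ⬝ᵥ B s = y t ⬝ᵥ y s + x t ⬝ᵥ x s := by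
    intro t s
    simp [B, dotProduct, Fintype.sum_sum_type]
  calc _ = ∫ ω, S (fun i j => ω (Sum.inl (i, j))) ∂(Measure.pi
          fun _ : (Fin n × Fin k) ⊕ (Fin n ⊕ Fin k) => gaussianReal 0 v) := by
        rw [← mp.map_eq]
        exact integral_map mp.measurable.aemeasurable
          (by rw [mp.map_eq]; exact hS.aestronglyMeasurable)
    _ ≤ ∫ ω, (euclNorm (ω ∘ fun i => Sum.inr (Sum.inl i))
          + euclNorm (ω ∘ fun j => Sum.inr (Sum.inr j))) ∂(Measure.pi
          fun _ : (Fin n × Fin k) ⊕ (Fin n ⊕ Fin k) => gaussianReal 0 v) := by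
        refine integral_le_integral_of_mulVec hv (A := A) (B := B) (fun t s => ?_) (fun t s => ?_)
          (mp.integrable_comp_of_integrable hS)
          ((integrable_euclNorm_comp v _).add (integrable_euclNorm_comp v _))
          (fun ω => ?_) (fun ω t => ?_)
        · simp [A, B, dotProduct, Fintype.sum_sum_type]
        · have ha : y t ⬝ᵥ y s ≤ 1 := (dotProduct_le_euclNorm_mul _ _).trans_eq
            (by rw [euclNorm_one (hy t), euclNorm_one (hy s), one_mul])
          have hb : x t ⬝ᵥ x s ≤ 1 := (dotProduct_le_euclNorm_mul _ _).trans_eq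
            (by rw [euclNorm_one (hx t), euclNorm_one (hx s), one_mul])
          simp only [sub_dotProduct, dotProduct_sub, hAA, hBB, hy, hx,
            dotProduct_comm (y s) (y t), dotProduct_comm (x s) (x t)]
          nlinarith [mul_nonneg (sub_nonneg.2 ha) (sub_nonneg.2 hb)]
        · obtain ⟨t, ht⟩ := hle fun i j => ω (Sum.inl (i, j))
          refine ⟨t, ht.trans_eq ?_⟩
          simp only [A, mulVec, dotProduct, Fintype.sum_sum_type, Fintype.sum_prod_type,
            Sum.elim_inl, Sum.elim_inr, Pi.zero_apply, zero_mul, Finset.sum_const_zero, add_zero,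
            Finset.mul_sum]
          exact Finset.sum_congr rfl fun i _ => Finset.sum_congr rfl fun j _ => by ring
        · have h1 := dotProduct_le_euclNorm_mul (y t) (ω ∘ fun i => Sum.inr (Sum.inl i))
          have h2 := dotProduct_le_euclNorm_mul (x t) (ω ∘ fun j => Sum.inr (Sum.inr j))
          rw [euclNorm_one (hy t), one_mul] at h1
          rw [euclNorm_one (hx t), one_mul] at h2
          refine le_trans (le_of_eq ?_) (add_le_add h1 h2)
          simp [B, mulVec, dotProduct, Fintype.sum_sum_type]
    _ ≤ _ := by
        rw [integral_add (integrable_euclNorm_comp v _) (integrable_euclNorm_comp v _)]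
        exact add_le_add (integral_euclNorm_comp_le hv hn _) (integral_euclNorm_comp_le hv hk _)

lemma exists_finset_unit_net (E : Type*) [NormedAddCommGroup E] [NormedSpace ℝ E]
    [FiniteDimensional ℝ E] {ε : ℝ} (hε : 0 < ε) :
    ∃ N : Finset E, (∀ u ∈ N, ‖u‖ = 1) ∧ ∀ x : E, ‖x‖ = 1 → ∃ u ∈ N, ‖x - u‖ ≤ ε := by
  obtain ⟨t, hts, htf, hcov⟩ := (isCompact_sphere (0 : E) 1).finite_cover_balls hε
  refine ⟨htf.toFinset, fun u hu => ?_, fun x hx => ?_⟩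
  · simpa using hts (htf.mem_toFinset.1 hu)
  · have := hcov (show x ∈ Metric.sphere (0 : E) 1 by simpa using hx)
    simp only [Set.mem_iUnion, Metric.mem_ball, dist_eq_norm] at this
    obtain ⟨u, hu, h⟩ := this
    exact ⟨u, htf.mem_toFinset.2 hu, h.le⟩

/-- The operator norm is almost attained by the bilinear form on pairs of a net. -/
lemma exists_mul_opNorm_le_inner {E F : Type*} [NormedAddCommGroup E] [InnerProductSpace ℝ E]
    [Nontrivial E] [NormedAddCommGroup F] [InnerProductSpace ℝ F] [Nontrivial F] (Φ : E →L[ℝ] F)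
    {ε : ℝ} {N : Finset E} {P : Finset F} (hP1 : ∀ w ∈ P, ‖w‖ = 1)
    (hN : ∀ x : E, ‖x‖ = 1 → ∃ u ∈ N, ‖x - u‖ ≤ ε)
    (hP : ∀ y : F, ‖y‖ = 1 → ∃ w ∈ P, ‖y - w‖ ≤ ε) :
    ∃ w ∈ P, ∃ u ∈ N, (1 - 2 * ε) * ‖Φ‖ ≤ inner ℝ w (Φ u) := by
  obtain ⟨x₀, hx₀⟩ := exists_norm_eq E zero_le_one
  obtain ⟨y₀, hy₀⟩ := exists_norm_eq F zero_le_one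
  obtain ⟨u₀, hu₀, -⟩ := hN x₀ hx₀
  obtain ⟨w₀, hw₀, -⟩ := hP y₀ hy₀
  obtain ⟨⟨w, u⟩, hwu, hmax⟩ := (P ×ˢ N).exists_max_image (fun p => inner ℝ p.1 (Φ p.2))
    ⟨(w₀, u₀), Finset.mem_product.2 ⟨hw₀, hu₀⟩⟩
  rw [Finset.mem_product] at hwu
  refine ⟨w, hwu.1, u, hwu.2, ?_⟩
  set m := inner ℝ w (Φ u)
  have bilin : ∀ x y, ‖x‖ = 1 → ‖y‖ = 1 → inner ℝ y (Φ x) ≤ m + 2 * ε * ‖Φ‖ := by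
    intro x y hx hy
    obtain ⟨u', hu', hxu⟩ := hN x hx
    obtain ⟨w', hw', hyw⟩ := hP y hy
    have h0 : inner ℝ w' (Φ u') ≤ m := hmax (w', u') (Finset.mem_product.2 ⟨hw', hu'⟩)
    have h1 : inner ℝ (y - w') (Φ x) ≤ ε * ‖Φ‖ := by
      refine (real_inner_le_norm _ _).trans (mul_le_mul hyw ?_ (norm_nonneg _)
        ((norm_nonneg _).trans hyw))
      simpa [hx] using Φ.le_opNorm x
    have h2 : inner ℝ w' (Φ (x - u')) ≤ ε * ‖Φ‖ := by
      refine (real_inner_le_norm _ _).trans ?_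
      rw [hP1 w' hw', one_mul, mul_comm]
      exact (Φ.le_opNorm _).trans (by gcongr)
    have e : inner ℝ y (Φ x)
        = inner ℝ w' (Φ u') + inner ℝ (y - w') (Φ x) + inner ℝ w' (Φ (x - u')) := by
      rw [map_sub, inner_sub_left, inner_sub_right]; ring
    linarith
  have unit : ∀ x, ‖x‖ = 1 → ‖Φ x‖ ≤ m + 2 * ε * ‖Φ‖ := by
    intro x hx
    by_cases h : Φ x = 0
    · simpa [h] using bilin x y₀ hx hy₀
    · have hne : ‖Φ x‖ ≠ 0 := norm_ne_zero_iff.2 h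
      have := bilin x (‖Φ x‖⁻¹ • Φ x) hx (by rw [norm_smul, norm_inv, norm_norm,
        inv_mul_cancel₀ hne])
      rwa [real_inner_smul_left, real_inner_self_eq_norm_sq, sq, inv_mul_cancel_left₀ hne] at this
  have := ContinuousLinearMap.opNorm_le_of_unit_norm ((norm_nonneg _).trans (unit x₀ hx₀)) unit
  linarith

lemma specNorm_le_norm_toEuclideanLin {n k : ℕ} (M : Matrix (Fin n) (Fin k) ℝ) :
    specNorm M ≤ ‖LinearMap.toContinuousLinearMap (toEuclideanLin M)‖ := by
  have hnorm : ∀ {m : ℕ} (x : Fin m → ℝ), euclNorm x = ‖WithLp.toLp 2 x‖ := fun x => by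
    simp [euclNorm, EuclideanSpace.norm_eq]
  refine csSup_le ⟨_, 0, by simp [euclNorm], rfl⟩ ?_
  rintro r ⟨x, hx, rfl⟩
  rw [hnorm] at hx ⊢
  exact (LinearMap.toContinuousLinearMap (toEuclideanLin M)).unit_le_opNorm _ hx

/-- **Gordon's bound.**  If `G` is an `n × k` random matrix with independent `N(0, 1/n)`
entries and `k ≤ n`, then `E ‖G‖ ≤ 1 + √(k/n)` for the spectral norm. -/
theorem expected_spectral_norm_gaussian
    (n k : ℕ) (hn : 0 < n) (hk : 0 < k) (hkn : k ≤ n)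
    (ν : Measure (Matrix (Fin n) (Fin k) ℝ))
    (hν : ν = Measure.pi fun _ : Fin n => Measure.pi fun _ : Fin k =>
      gaussianReal 0 ((n : NNReal))⁻¹) :
    ∫ G, specNorm G ∂ν ≤ 1 + Real.sqrt ((k : ℝ) / n) := by
  by_cases h_int : Integrable specNorm ν
  swap
  · rw [integral_undef h_int]; positivity
  have : Nonempty (Fin n) := ⟨⟨0, hn⟩⟩
  have : Nonempty (Fin k) := ⟨⟨0, hk⟩⟩
  have hn0 : (n : ℝ) ≠ 0 := by exact_mod_cast hn.ne'
  have hv : ((n : NNReal))⁻¹ ≠ 0 := inv_ne_zero (by exact_mod_cast hn.ne')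
  have net : ∀ ε : ℝ, 0 < ε → ε < 1 / 2 →
      (1 - 2 * ε) * ∫ G, specNorm G ∂ν ≤ 1 + Real.sqrt ((k : ℝ) / n) := by
    intro ε hε hε2
    obtain ⟨N, hN1, hN⟩ := exists_finset_unit_net (EuclideanSpace ℝ (Fin k)) hε
    obtain ⟨P, hP1, hP⟩ := exists_finset_unit_net (EuclideanSpace ℝ (Fin n)) hε
    have key : ∀ M : Matrix (Fin n) (Fin k) ℝ, ∃ t : P × N, (1 - 2 * ε) * specNorm M
        ≤ (t.1.1 : Fin n → ℝ) ⬝ᵥ (M *ᵥ (t.2.1 : Fin k → ℝ)) := by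
      intro M
      obtain ⟨w, hw, u, hu, h⟩ := exists_mul_opNorm_le_inner
        (LinearMap.toContinuousLinearMap (toEuclideanLin M)) hP1 hN hP
      refine ⟨(⟨w, hw⟩, ⟨u, hu⟩), ?_⟩
      refine (mul_le_mul_of_nonneg_left (specNorm_le_norm_toEuclideanLin M)
        (by linarith)).trans (h.trans_eq ?_)
      simp [PiLp.inner_apply, dotProduct, mul_comm, toLpLin_apply]
    have unit : ∀ {m : ℕ} (z : EuclideanSpace ℝ (Fin m)), ‖z‖ = 1 →
        (z : Fin m → ℝ) ⬝ᵥ (z : Fin m → ℝ) = 1 := by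
      intro m z hz
      have := EuclideanSpace.real_norm_sq_eq z
      rw [hz, one_pow] at this
      rw [this]
      exact Finset.sum_congr rfl fun i _ => (sq _).symm
    have : Nonempty (P × N) := ⟨(key 0).choose⟩
    subst hν
    have := integral_le_of_exists_le_dotProduct_mulVec hn hk hv
      (fun t : P × N => unit t.1.1 (hP1 _ t.1.2)) (fun t : P × N => unit t.2.1 (hN1 _ t.2.2))
      (h_int.const_mul (1 - 2 * ε)) key
    refine (integral_const_mul _ _).symm.trans_le (this.trans_eq ?_)
    simp [hn0, div_eq_mul_inv]
  refine le_of_tendsto (f := fun ε : ℝ => (1 - 2 * ε) * ∫ G, specNorm G ∂ν)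
    (x := nhdsWithin 0 (Set.Ioi 0)) ?_ ?_
  · have : Continuous fun ε : ℝ => (1 - 2 * ε) * ∫ G, specNorm G ∂ν := by fun_prop
    simpa using (this.tendsto 0).mono_left nhdsWithin_le_nhds
  · filter_upwards [Ioo_mem_nhdsGT (show (0 : ℝ) < 1 / 2 by norm_num)] with ε hε
    exact net ε hε.1 hε.2
end

section
/- Let Q be a random n × n matrix distributed according to the Haar probability measure on the orthogonal group O(n). Then the expected maximum absolute entry satisfies E max_{i,j} |Q_{ij}| ≤ 3 √((log n + 1/4)/n). -/
open MeasureTheory ProbabilityTheory Matrix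

theorem exists_orthogonal_row {n : ℕ} (i : Fin n) (u : Fin n → ℝ) (hu : ∑ k, u k ^ 2 = 1) :
    ∃ U : Matrix (Fin n) (Fin n) ℝ, Uᵀ * U = 1 ∧ ∀ k, U i k = u k := by
  have hnorm : ‖WithLp.toLp 2 u‖ = 1 := by
    rw [EuclideanSpace.norm_eq]
    simp [hu]
  have horth : Orthonormal ℝ (({i} : Set (Fin n)).domRestrict
      (fun _ : Fin n => (WithLp.toLp 2 u : EuclideanSpace ℝ (Fin n)))) := by
    refine ⟨fun _ => hnorm, fun a b hab => (hab (Subsingleton.elim a b)).elim⟩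
  obtain ⟨b, hb⟩ := horth.exists_orthonormalBasis_extension_of_card_eq (by simp)
  refine ⟨Matrix.of fun k l => b k l, ?_, fun k => ?_⟩
  · rw [mul_eq_one_comm]
    ext k l
    have h := orthonormal_iff_ite.mp b.orthonormal k l
    rw [PiLp.inner_apply] at h
    rw [Matrix.mul_apply, Matrix.one_apply, ← h]
    exact Finset.sum_congr rfl fun x _ => by simp [mul_comm]
  · simp [hb i rfl]

theorem measurable_matrix_entry {n k : ℕ} (i : Fin n) (j : Fin k) :
    Measurable (fun Q : Matrix (Fin n) (Fin k) ℝ => Q i j) :=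
  (measurable_pi_apply j).comp (measurable_pi_apply i)

theorem sum_sq_col_eq_one {n : ℕ} {Q : Matrix (Fin n) (Fin n) ℝ} (hQ : Qᵀ * Q = 1) (j : Fin n) :
    ∑ k, Q k j ^ 2 = 1 := by
  have h := congrFun (congrFun hQ j) j
  simpa [Matrix.mul_apply, sq] using h

theorem abs_entry_le_one {n : ℕ} {Q : Matrix (Fin n) (Fin n) ℝ} (hQ : Qᵀ * Q = 1) (i j : Fin n) :
    |Q i j| ≤ 1 := by
  rw [← sq_le_one_iff_abs_le_one, ← sum_sq_col_eq_one hQ j]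
  exact Finset.single_le_sum (f := fun k => Q k j ^ 2) (fun k _ => sq_nonneg _) (Finset.mem_univ i)

theorem integrable_exp_sum_col {n : ℕ} (μ : Measure (Matrix (Fin n) (Fin n) ℝ))
    [IsProbabilityMeasure μ] (hμ_orth : ∀ᵐ Q ∂μ, Qᵀ * Q = 1) (c : Fin n → ℝ) (j : Fin n) :
    Integrable (fun Q => Real.exp (∑ k, c k * Q k j)) μ := by
  refine Integrable.of_bound (C := Real.exp (∑ k, |c k|)) ?_ ?_
  · exact (Real.measurable_exp.comp (Finset.measurable_sum _ fun k _ =>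
      (measurable_matrix_entry k j).const_mul (c k))).aestronglyMeasurable
  · filter_upwards [hμ_orth] with Q hQ
    rw [Real.norm_eq_abs, Real.abs_exp, Real.exp_le_exp]
    refine Finset.sum_le_sum fun k _ => (le_abs_self _).trans ?_
    rw [abs_mul]
    exact mul_le_of_le_one_right (abs_nonneg _) (abs_entry_le_one hQ k j)

theorem integrable_exp_entry {n : ℕ} (μ : Measure (Matrix (Fin n) (Fin n) ℝ))
    [IsProbabilityMeasure μ] (hμ_orth : ∀ᵐ Q ∂μ, Qᵀ * Q = 1) (t : ℝ) (i j : Fin n) :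
    Integrable (fun Q => Real.exp (t * Q i j)) μ := by
  simpa [Pi.single_apply] using integrable_exp_sum_col μ hμ_orth (Pi.single i t) j

theorem integral_exp_entry_eq {n : ℕ} (μ : Measure (Matrix (Fin n) (Fin n) ℝ))
    (hμ_inv : ∀ U : Matrix (Fin n) (Fin n) ℝ, Uᵀ * U = 1 → μ.map (fun Q => U * Q) = μ)
    (u : Fin n → ℝ) (hu : ∑ k, u k ^ 2 = 1) (t : ℝ) (i j : Fin n) :
    ∫ Q, Real.exp (t * Q i j) ∂μ = ∫ Q, Real.exp (t * ∑ k, u k * Q k j) ∂μ := by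
  obtain ⟨U, hU, hrow⟩ := exists_orthogonal_row i u hu
  have hmeas : Measurable (fun Q : Matrix (Fin n) (Fin n) ℝ => U * Q) := by
    refine measurable_pi_iff.mpr fun a => measurable_pi_iff.mpr fun b => ?_
    simp only [Matrix.mul_apply]
    exact Finset.measurable_sum _ fun k _ => (measurable_matrix_entry k b).const_mul (U a k)
  have hexp : Measurable (fun Q : Matrix (Fin n) (Fin n) ℝ => Real.exp (t * Q i j)) :=
    Real.measurable_exp.comp ((measurable_matrix_entry i j).const_mul t)
  conv_lhs => rw [← hμ_inv U hU]
  rw [integral_map hmeas.aemeasurable hexp.aestronglyMeasurable]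
  simp only [Matrix.mul_apply, hrow]

/-- The entries of a random orthogonal matrix are sub-Gaussian with variance proxy `1 / n`. -/
theorem integral_exp_entry_le {n : ℕ} (hn : 0 < n) (μ : Measure (Matrix (Fin n) (Fin n) ℝ))
    [IsProbabilityMeasure μ] (hμ_orth : ∀ᵐ Q ∂μ, Qᵀ * Q = 1)
    (hμ_inv : ∀ U : Matrix (Fin n) (Fin n) ℝ, Uᵀ * U = 1 → μ.map (fun Q => U * Q) = μ)
    (s : ℝ) (i j : Fin n) :
    ∫ Q, Real.exp (s * √n * Q i j) ∂μ ≤ Real.exp (s ^ 2 / 2) := by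
  have hn' : (0 : ℝ) < n := Nat.cast_pos.mpr hn
  have hsqrt : √(n : ℝ) ≠ 0 := (Real.sqrt_pos.mpr hn').ne'
  let signs : Finset (Fin n → ℝ) := Fintype.piFinset fun _ => {1, -1}
  have hcard : signs.card = 2 ^ n := by
    rw [Fintype.card_piFinset_const, Finset.card_pair (by norm_num)]
  have hsign (ε : Fin n → ℝ) (hε : ε ∈ signs) :
      ∫ Q, Real.exp (s * √n * Q i j) ∂μ = ∫ Q, Real.exp (∑ k, s * ε k * Q k j) ∂μ := by
    have hε2 (k : Fin n) : ε k ^ 2 = 1 := by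
      have := Fintype.mem_piFinset.mp hε k
      simp only [Finset.mem_insert, Finset.mem_singleton] at this
      rcases this with h | h <;> simp [h]
    rw [integral_exp_entry_eq μ hμ_inv (fun k => ε k / √n)]
    · congr with Q
      rw [Finset.mul_sum]
      congr 1
      refine Finset.sum_congr rfl fun k _ => ?_
      field_simp
    · simp only [div_pow, hε2, Real.sq_sqrt hn'.le]
      simp [hn'.ne']
  have hpow : (0 : ℝ) < 2 ^ n := by positivity
  refine le_of_mul_le_mul_left ?_ hpow
  calc (2 : ℝ) ^ n * ∫ Q, Real.exp (s * √n * Q i j) ∂μ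
      = ∑ ε ∈ signs, ∫ Q, Real.exp (∑ k, s * ε k * Q k j) ∂μ := by
        rw [← Finset.sum_congr rfl hsign, Finset.sum_const, hcard]
        simp
    _ = ∫ Q, ∑ ε ∈ signs, Real.exp (∑ k, s * ε k * Q k j) ∂μ :=
        (integral_finsetSum _ fun ε _ => integrable_exp_sum_col μ hμ_orth _ j).symm
    _ ≤ ∫ _, 2 ^ n * Real.exp (s ^ 2 / 2) ∂μ := by
        refine integral_mono_ae
          (integrable_finsetSum _ fun ε _ => integrable_exp_sum_col μ hμ_orth _ j)
          (integrable_const _) ?_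
        filter_upwards [hμ_orth] with Q hQ
        calc ∑ ε ∈ signs, Real.exp (∑ k, s * ε k * Q k j)
            = ∏ k, ∑ e ∈ ({1, -1} : Finset ℝ), Real.exp (s * e * Q k j) := by
              rw [Finset.prod_univ_sum]
              exact Finset.sum_congr rfl fun ε _ => Real.exp_sum _ _
          _ = ∏ k, 2 * Real.cosh (s * Q k j) := by
              refine Finset.prod_congr rfl fun k _ => ?_
              rw [Finset.sum_pair (by norm_num), Real.cosh_eq]
              ring_nf
          _ ≤ ∏ k, 2 * Real.exp ((s * Q k j) ^ 2 / 2) := by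
              refine Finset.prod_le_prod
                (fun k _ => mul_nonneg zero_le_two (Real.cosh_pos _).le) fun k _ => ?_
              exact mul_le_mul_of_nonneg_left (Real.cosh_le_exp_half_sq _) zero_le_two
          _ = 2 ^ n * Real.exp (s ^ 2 / 2) := by
              rw [Finset.prod_mul_distrib, ← Real.exp_sum]
              simp only [mul_pow, mul_div_right_comm]
              rw [← Finset.mul_sum, sum_sq_col_eq_one hQ j]
              simp
    _ = 2 ^ n * Real.exp (s ^ 2 / 2) := by simp

theorem exists_iSup_abs_entry_eq {n : ℕ} (hn : 0 < n) (Q : Matrix (Fin n) (Fin n) ℝ) :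
    ∃ i j, ⨆ i : Fin n, ⨆ j : Fin n, |Q i j| = |Q i j| := by
  have : Nonempty (Fin n) := ⟨⟨0, hn⟩⟩
  obtain ⟨i, hi⟩ := exists_eq_ciSup_of_finite (f := fun i => ⨆ j : Fin n, |Q i j|)
  obtain ⟨j, hj⟩ := exists_eq_ciSup_of_finite (f := fun j => |Q i j|)
  exact ⟨i, j, by rw [← hi, ← hj]⟩

theorem exp_mul_iSup_abs_entry_le {n : ℕ} (hn : 0 < n) (Q : Matrix (Fin n) (Fin n) ℝ) (t : ℝ) :
    Real.exp (t * ⨆ i : Fin n, ⨆ j : Fin n, |Q i j|) ≤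
      ∑ i, ∑ j, (Real.exp (t * Q i j) + Real.exp (-t * Q i j)) := by
  obtain ⟨i, j, h⟩ := exists_iSup_abs_entry_eq hn Q
  have hnonneg (i j : Fin n) : 0 ≤ Real.exp (t * Q i j) + Real.exp (-t * Q i j) := by positivity
  rw [h]
  calc Real.exp (t * |Q i j|) ≤ Real.exp (t * Q i j) + Real.exp (-t * Q i j) := by
        rcases abs_choice (Q i j) with h | h <;> rw [h]
        · exact le_add_of_nonneg_right (Real.exp_pos _).le
        · rw [mul_neg, ← neg_mul]
          exact le_add_of_nonneg_left (Real.exp_pos _).le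
    _ ≤ ∑ j, (Real.exp (t * Q i j) + Real.exp (-t * Q i j)) :=
        Finset.single_le_sum (f := fun j => Real.exp (t * Q i j) + Real.exp (-t * Q i j))
          (fun j _ => hnonneg i j) (Finset.mem_univ j)
    _ ≤ _ := Finset.single_le_sum
          (f := fun i => ∑ j, (Real.exp (t * Q i j) + Real.exp (-t * Q i j)))
          (fun i _ => Finset.sum_nonneg fun j _ => hnonneg i j) (Finset.mem_univ i)

theorem mul_integral_iSup_abs_entry_le {n : ℕ} (hn : 0 < n)
    (μ : Measure (Matrix (Fin n) (Fin n) ℝ))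
    [IsProbabilityMeasure μ] (hμ_orth : ∀ᵐ Q ∂μ, Qᵀ * Q = 1)
    (hμ_inv : ∀ U : Matrix (Fin n) (Fin n) ℝ, Uᵀ * U = 1 → μ.map (fun Q => U * Q) = μ)
    {s : ℝ} (hs : 0 < s) :
    s * √n * ∫ Q, (⨆ i : Fin n, ⨆ j : Fin n, |Q i j|) ∂μ ≤
      Real.log 2 + 2 * Real.log n + s ^ 2 / 2 := by
  have hn' : (0 : ℝ) < n := Nat.cast_pos.mpr hn
  set L := Real.log 2 + 2 * Real.log n + s ^ 2 / 2 with hL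
  have hexpL : Real.exp L = 2 * n ^ 2 * Real.exp (s ^ 2 / 2) := by
    rw [hL, Real.exp_add, Real.exp_add, Real.exp_log two_pos, two_mul (Real.log n), Real.exp_add,
      Real.exp_log hn', sq (n : ℝ)]
  let S : Matrix (Fin n) (Fin n) ℝ → ℝ := fun Q =>
    ∑ i, ∑ j, (Real.exp (s * √n * Q i j) + Real.exp (-(s * √n) * Q i j))
  have h_integrable (i j : Fin n) : Integrable
      (fun Q => Real.exp (s * √n * Q i j) + Real.exp (-(s * √n) * Q i j)) μ :=
    (integrable_exp_entry μ hμ_orth _ i j).add (integrable_exp_entry μ hμ_orth _ i j)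
  have hSint : Integrable S μ :=
    integrable_finsetSum _ fun i _ => integrable_finsetSum _ fun j _ => h_integrable i j
  have hS : ∫ Q, S Q ∂μ ≤ Real.exp L := by
    calc ∫ Q, S Q ∂μ
        = ∑ i, ∑ j, (∫ Q, Real.exp (s * √n * Q i j) ∂μ +
            ∫ Q, Real.exp (-s * √n * Q i j) ∂μ) := by
          rw [integral_finsetSum _ fun i _ => integrable_finsetSum _ fun j _ => h_integrable i j]
          refine Finset.sum_congr rfl fun i _ => ?_
          rw [integral_finsetSum _ fun j _ => h_integrable i j]
          refine Finset.sum_congr rfl fun j _ => ?_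
          rw [integral_add (integrable_exp_entry μ hμ_orth _ i j)
            (integrable_exp_entry μ hμ_orth _ i j), neg_mul]
      _ ≤ ∑ _i : Fin n, ∑ _j : Fin n, (Real.exp (s ^ 2 / 2) + Real.exp (s ^ 2 / 2)) := by
          refine Finset.sum_le_sum fun i _ => Finset.sum_le_sum fun j _ => ?_
          have hneg := integral_exp_entry_le hn μ hμ_orth hμ_inv (-s) i j
          rw [neg_sq] at hneg
          exact add_le_add (integral_exp_entry_le hn μ hμ_orth hμ_inv s i j) hneg
      _ = Real.exp L := by
          rw [hexpL]
          simp
          ring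
  have hpoint (Q : Matrix (Fin n) (Fin n) ℝ) :
      s * √n * (⨆ i : Fin n, ⨆ j : Fin n, |Q i j|) ≤ L - 1 + S Q / Real.exp L := by
    have h1 := Real.add_one_le_exp (s * √n * (⨆ i : Fin n, ⨆ j : Fin n, |Q i j|) - L)
    have h2 := div_le_div_of_nonneg_right (exp_mul_iSup_abs_entry_le hn Q (s * √n))
      (Real.exp_pos L).le
    rw [Real.exp_sub] at h1
    linarith
  rw [← integral_const_mul]
  calc ∫ Q, s * √n * (⨆ i : Fin n, ⨆ j : Fin n, |Q i j|) ∂μ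
      ≤ ∫ Q, (L - 1 + S Q / Real.exp L) ∂μ := by
        refine integral_mono_of_nonneg (ae_of_all _ fun Q => ?_)
          ((integrable_const _).add (hSint.div_const _)) (ae_of_all _ hpoint)
        exact mul_nonneg (by positivity)
          (Real.iSup_nonneg fun i => Real.iSup_nonneg fun j => abs_nonneg _)
    _ = L - 1 + (∫ Q, S Q ∂μ) / Real.exp L := by
        rw [integral_add (integrable_const _) (hSint.div_const _), integral_div]
        simp
    _ ≤ L := by
        have := (div_le_one (Real.exp_pos L)).mpr hS
        linarith

/-- **Maximum entry of a random orthogonal matrix.**  If `μ` is the Haar probability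
measure on the orthogonal group `O(n)` (characterized as a probability measure supported
on orthogonal matrices and invariant under left multiplication by orthogonal matrices),
then `E max_{i,j} |Q_{ij}| ≤ 3 √((log n + 1/4)/n)`. -/
theorem expected_max_entry_orthogonal
    (n : ℕ) (hn : 0 < n)
    (μ : Measure (Matrix (Fin n) (Fin n) ℝ)) [IsProbabilityMeasure μ]
    (hμ_orth : ∀ᵐ Q ∂μ, Qᵀ * Q = 1)
    (hμ_inv : ∀ U : Matrix (Fin n) (Fin n) ℝ, Uᵀ * U = 1 →
      μ.map (fun Q => U * Q) = μ) :
    ∫ Q, (⨆ i : Fin n, ⨆ j : Fin n, |Q i j|) ∂μ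
      ≤ 3 * Real.sqrt ((Real.log n + 1 / 4) / n) := by
  have hn' : (0 : ℝ) < n := Nat.cast_pos.mpr hn
  have hlog : 0 ≤ Real.log n := Real.log_natCast_nonneg n
  have hpos : 0 < Real.log n + 1 / 4 := by linarith
  have hsq := Real.sq_sqrt hpos.le
  have hr := Real.sqrt_pos.mpr hpos
  have hbound := mul_integral_iSup_abs_entry_le hn μ hμ_orth hμ_inv (mul_pos two_pos hr)
  rw [Real.sqrt_div hpos.le, ← mul_div_assoc, le_div_iff₀ (Real.sqrt_pos.mpr hn')]
  refine le_of_mul_le_mul_left ?_ (mul_pos two_pos hr)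
  have hlog2 := Real.log_two_lt_d9
  nlinarith
end
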